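/- The 7×7 integer matrix W with rows [-1,-1,-1,-1,0,0,0], [1,0,0,0,-1,0,0], [-1,0,0,0,0,-1,0], [1,0,0,0,0,0,-1], [0,1,0,0,1,0,0], [0,0,-1,0,0,1,0], [0,0,0,1,0,0,1] has determinant -2, and hence is not totally unimodular; moreover every proper square submatrix of W has determinant in {-1,0,1} (W is minimally non-totally-unimodular). -/

import Mathlib

/-- A matrix is totally unimodular if every square submatrix has determinant 0, 1 or -1. -/
def IsTotUnimod {R : Type*} [CommRing R] {m n : Type*} (A : Matrix m n R) : Prop :=
  ∀ (k : ℕ) (f : Fin k → m) (g : Fin k → n), Function.Injective f → Function.Injective g →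
    (A.submatrix f g).det ∈ ({-1, 0, 1} : Set R)

/-- The alternating sum of `a c * F l` over the entries `c` of a list, where `l` is the list with
`c` removed; terms with `a c = 0` are skipped without evaluating `F`. -/
def laplaceSum {n : Type*} (a : n → ℤ) : List n → (List n → ℤ) → ℤ
  | [], _ => 0
  | c :: cs, F =>
    (match a c with
      | 0 => 0
      | x => x * F cs) - laplaceSum a cs fun l => F (c :: l)

/-- The minor of `A` with the listed rows and columns, by Laplace expansion along the first row. -/
def listMinor {m n : Type*} (A : Matrix m n ℤ) : List m → List n → ℤ
  | [], _ => 1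
  | i :: is, cols => laplaceSum (A i) cols (listMinor A is)

theorem laplaceSum_ofFn {n : Type*} (a : n → ℤ) {k : ℕ} (g : Fin (k + 1) → n) (F : List n → ℤ) :
    laplaceSum a (List.ofFn g) F =
      ∑ j : Fin (k + 1), (-1) ^ (j : ℕ) * a (g j) * F (List.ofFn (g ∘ j.succAbove)) := by
  have h_cons (c : n) (cs : List n) (F : List n → ℤ) :
      laplaceSum a (c :: cs) F = a c * F cs - laplaceSum a cs fun l => F (c :: l) := by
    rw [laplaceSum]
    split <;> simp [*]
  induction k generalizing F with
  | zero => simp [h_cons, laplaceSum]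
  | succ k ih =>
    rw [List.ofFn_succ, h_cons, ih, Fin.sum_univ_succ (n := k + 1), sub_eq_add_neg,
      ← Finset.sum_neg_distrib]
    congr 1
    · simp [Function.comp_def]
    · refine Finset.sum_congr rfl fun j _ => ?_
      simp [Function.comp_def, pow_succ]

theorem det_submatrix_eq_listMinor {m n : Type*} (A : Matrix m n ℤ) {k : ℕ} (f : Fin k → m)
    (g : Fin k → n) :
    (A.submatrix f g).det = listMinor A (List.ofFn f) (List.ofFn g) := by
  induction k with
  | zero => simp [listMinor]
  | succ k ih =>
    rw [Matrix.det_succ_row_zero, List.ofFn_succ (f := f), listMinor, laplaceSum_ofFn]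
    simp only [Matrix.submatrix_submatrix, Matrix.submatrix_apply, ih]
    rfl

theorem StrictMono.ofFn_sublist_finRange {k n : ℕ} {f : Fin k → Fin n} (hf : StrictMono f) :
    (List.ofFn f).Sublist (List.finRange n) :=
  List.sublist_of_subperm_of_sortedLE
    (List.subperm_of_subset (List.nodup_ofFn.2 hf.injective) fun i _ => List.mem_finRange i)
    hf.sortedLT_ofFn.sortedLE (List.sortedLT_finRange n).sortedLE

theorem Function.Injective.strictMono_comp_sort {k n : ℕ} {f : Fin k → Fin n}
    (hf : Function.Injective f) : StrictMono (f ∘ Tuple.sort f) :=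
  (Tuple.monotone_sort f).strictMono_of_injective (hf.comp (Tuple.sort f).injective)

/-- To bound all `k × k` minors it suffices to bound those with increasing rows and columns. -/
theorem det_submatrix_mem_of_natAbs_listMinor_le_one {m n k : ℕ} (A : Matrix (Fin m) (Fin n) ℤ)
    (h : ∀ r ∈ (List.finRange m).sublistsLen k, ∀ c ∈ (List.finRange n).sublistsLen k,
      (listMinor A r c).natAbs ≤ 1)
    {f : Fin k → Fin m} {g : Fin k → Fin n}
    (hf : Function.Injective f) (hg : Function.Injective g) :
    (A.submatrix f g).det ∈ ({-1, 0, 1} : Set ℤ) := by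
  have hs := h
    _ (List.mem_sublistsLen.2 ⟨hf.strictMono_comp_sort.ofFn_sublist_finRange, List.length_ofFn⟩)
    _ (List.mem_sublistsLen.2 ⟨hg.strictMono_comp_sort.ofFn_sublist_finRange, List.length_ofFn⟩)
  rw [← det_submatrix_eq_listMinor] at hs
  have hr := Matrix.det_permute (Tuple.sort f) (A.submatrix f (g ∘ Tuple.sort g))
  have hc := Matrix.det_permute' (Tuple.sort g) (A.submatrix f g)
  simp only [Matrix.submatrix_submatrix, Function.comp_id, Int.cast_id] at hr hc
  rw [hr, hc, Int.natAbs_mul, Int.natAbs_mul, Int.units_natAbs, Int.units_natAbs] at hs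
  simp only [Set.mem_insert_iff, Set.mem_singleton_iff]
  omega

/-- The matrix of `W7_minimally_not_TU`. -/
def W7 : Matrix (Fin 7) (Fin 7) ℤ :=
  !![-1, -1, -1, -1, 0, 0, 0;
     1, 0, 0, 0, -1, 0, 0;
     -1, 0, 0, 0, 0, -1, 0;
     1, 0, 0, 0, 0, 0, -1;
     0, 1, 0, 0, 1, 0, 0;
     0, 0, -1, 0, 0, 1, 0;
     0, 0, 0, 1, 0, 0, 1]

theorem det_W7 : W7.det = -2 := by
  rw [← Matrix.submatrix_id_id W7, det_submatrix_eq_listMinor]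
  decide +kernel

theorem natAbs_listMinor_W7_le_one :
    ∀ k < 7, ∀ r ∈ (List.finRange 7).sublistsLen k, ∀ c ∈ (List.finRange 7).sublistsLen k,
      (listMinor W7 r c).natAbs ≤ 1 := by
  decide +kernel

/-- The 7×7 matrix W is minimally non-totally-unimodular: det W = -2 (so W is not TU),
but every proper square submatrix has determinant in {-1,0,1}. -/
theorem W7_minimally_not_TU :
    (!![-1, -1, -1, -1, 0, 0, 0;
        1, 0, 0, 0, -1, 0, 0;
        -1, 0, 0, 0, 0, -1, 0;
        1, 0, 0, 0, 0, 0, -1;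
        0, 1, 0, 0, 1, 0, 0;
        0, 0, -1, 0, 0, 1, 0;
        0, 0, 0, 1, 0, 0, 1] : Matrix (Fin 7) (Fin 7) ℤ).det = -2 ∧
    ¬ IsTotUnimod
      (!![-1, -1, -1, -1, 0, 0, 0;
          1, 0, 0, 0, -1, 0, 0;
          -1, 0, 0, 0, 0, -1, 0;
          1, 0, 0, 0, 0, 0, -1;
          0, 1, 0, 0, 1, 0, 0;
          0, 0, -1, 0, 0, 1, 0;
          0, 0, 0, 1, 0, 0, 1] : Matrix (Fin 7) (Fin 7) ℤ) ∧
    ∀ (k : ℕ), k < 7 → ∀ (f : Fin k → Fin 7) (g : Fin k → Fin 7),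
      Function.Injective f → Function.Injective g →
      ((!![-1, -1, -1, -1, 0, 0, 0;
           1, 0, 0, 0, -1, 0, 0;
           -1, 0, 0, 0, 0, -1, 0;
           1, 0, 0, 0, 0, 0, -1;
           0, 1, 0, 0, 1, 0, 0;
           0, 0, -1, 0, 0, 1, 0;
           0, 0, 0, 1, 0, 0, 1] : Matrix (Fin 7) (Fin 7) ℤ).submatrix f g).det
        ∈ ({-1, 0, 1} : Set ℤ) := by
  refine ⟨det_W7, fun h => ?_, fun k hk f g hf hg =>
    det_submatrix_mem_of_natAbs_listMinor_le_one W7 (natAbs_listMinor_W7_le_one k hk) hf hg⟩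
  have h₇ := h 7 id id Function.injective_id Function.injective_id
  rw [Matrix.submatrix_id_id] at h₇
  change W7.det ∈ _ at h₇
  rw [det_W7] at h₇
  simp at h₇
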